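/- Consider the CnCZK audit model with a worst-case adversary: there are N data points, a fixed set B of c corrupted points (c ≤ N), and an L-layer model with 1 ≤ s ≤ L, where each corrupted point i carries exactly one corrupted layer ℓ_i ∈ {1,…,L}. The verifier draws a uniformly random m-element subset S of the N points (m ≤ N) and, independently for each point i, a uniformly random s-element subset T_i of the L layers; detection occurs iff there exists i ∈ S ∩ B with ℓ_i ∈ T_i. Then the probability of detection equals ∑_{k=0}^{min(c,m)} [C(c,k)·C(N−c,m−k)/C(N,m)] · [1 − ((L−s)/L)^k]. -/

import Mathlib

open Finset

lemma aux_hyper {α : Type} [Fintype α] [DecidableEq α] (B : Finset α) (m k : ℕ) (hk : k ≤ m) :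
    (((Finset.univ : Finset α).powersetCard m).filter (fun S => (S ∩ B).card = k)).card
      = Nat.choose B.card k * Nat.choose (Fintype.card α - B.card) (m - k) := by
  rw [← Finset.card_compl, ← Finset.card_powersetCard, ← Finset.card_powersetCard,
    ← Finset.card_product]
  refine Finset.card_nbij' (fun S => (S ∩ B, S \ B)) (fun p => p.1 ∪ p.2) ?_ ?_ ?_ ?_
  · intro S hS
    simp only [Finset.coe_filter, Set.mem_setOf_eq, Finset.mem_powersetCard] at hS
    simp only [Finset.mem_coe, Finset.mem_product, Finset.mem_powersetCard]
    have := Finset.card_inter_add_card_sdiff S B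
    refine ⟨⟨Finset.inter_subset_right, hS.2⟩, ?_, by omega⟩
    intro x hx
    simp at hx ⊢
    exact hx.2
  · rintro ⟨a, b⟩ h
    simp only [Finset.mem_coe, Finset.mem_product, Finset.mem_powersetCard] at h
    obtain ⟨⟨ha, hac⟩, hb, hbc⟩ := h
    simp only [Finset.coe_filter, Set.mem_setOf_eq, Finset.mem_powersetCard]
    have hd : Disjoint a b := by
      rw [Finset.disjoint_left]
      intro x hx hx'
      exact (Finset.mem_compl.1 (hb hx')) (ha hx)
    have he : (a ∪ b) ∩ B = a := by
      ext x
      have h1 := @ha x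
      have h2 := @hb x
      simp at h1 h2 ⊢
      tauto
    refine ⟨⟨Finset.subset_univ _, ?_⟩, by rw [he, hac]⟩
    rw [Finset.card_union_of_disjoint hd]
    omega
  · intro S hS
    ext x
    simp
    tauto
  · rintro ⟨a, b⟩ h
    simp only [Finset.mem_coe, Finset.mem_product, Finset.mem_powersetCard] at h
    obtain ⟨⟨ha, hac⟩, hb, hbc⟩ := h
    ext x
    all_goals
      have h1 := @ha x
      have h2 := @hb x
      simp at h1 h2 ⊢
      tauto

lemma aux_choose (L s : ℕ) (hL : 1 ≤ L) (hsL : s ≤ L) :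
    ((L - 1).choose s : ℝ) = (L.choose s : ℝ) * (((L : ℝ) - s) / L) := by
  obtain ⟨n, rfl⟩ : ∃ n, L = n + 1 := ⟨L - 1, by omega⟩
  have h := Nat.choose_mul_succ_eq n s
  have h' : ((n.choose s : ℕ) : ℝ) * ((n + 1 : ℕ) : ℝ)
      = ((n + 1).choose s : ℝ) * (((n + 1 : ℕ) : ℝ) - s) := by
    rw [← Nat.cast_sub hsL]
    exact_mod_cast h
  have h0 : ((n + 1 : ℕ) : ℝ) ≠ 0 := by positivity
  rw [Nat.add_sub_cancel, ← mul_div_assoc, eq_div_iff h0, h']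

lemma aux_miss {α β : Type} [Fintype α] [DecidableEq α] [Fintype β] [DecidableEq β]
    (s : ℕ) (hL : 1 ≤ Fintype.card β) (hsL : s ≤ Fintype.card β) (A : Finset α) (ℓ : α → β) :
    (((Fintype.piFinset fun _ : α => (Finset.univ : Finset β).powersetCard s).filter
      (fun T => ¬ ∃ i ∈ A, ℓ i ∈ T i)).card : ℝ)
      = ((Fintype.card β).choose s : ℝ) ^ (Fintype.card α) *
        (((Fintype.card β : ℝ) - s) / (Fintype.card β)) ^ A.card := by
  have h : ((Fintype.piFinset fun _ : α => (Finset.univ : Finset β).powersetCard s).filter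
      (fun T => ¬ ∃ i ∈ A, ℓ i ∈ T i)) = Fintype.piFinset (fun i : α =>
        if i ∈ A then ((Finset.univ : Finset β).erase (ℓ i)).powersetCard s
        else (Finset.univ : Finset β).powersetCard s) := by
    ext T
    simp only [Finset.mem_filter, Fintype.mem_piFinset, Finset.mem_powersetCard, not_exists,
      not_and]
    constructor
    · rintro ⟨h1, h2⟩ i
      split_ifs with hi
      · rw [Finset.mem_powersetCard, Finset.subset_erase]
        exact ⟨⟨(h1 i).1, h2 i hi⟩, (h1 i).2⟩
      · exact Finset.mem_powersetCard.2 (h1 i)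
    · intro h
      refine ⟨fun i => ?_, fun i hi => ?_⟩
      · have := h i
        split_ifs at this with hi
        · rw [Finset.mem_powersetCard] at this
          exact ⟨Finset.subset_univ _, this.2⟩
        · exact Finset.mem_powersetCard.1 this
      · have := h i
        rw [if_pos hi, Finset.mem_powersetCard, Finset.subset_erase] at this
        exact this.1.2
  rw [h, Fintype.card_piFinset, Nat.cast_prod]
  have h2 : ∀ i : α, (((if i ∈ A then ((Finset.univ : Finset β).erase (ℓ i)).powersetCard s
        else (Finset.univ : Finset β).powersetCard s).card : ℕ) : ℝ)
      = ((Fintype.card β).choose s : ℝ) *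
        (if i ∈ A then (((Fintype.card β : ℝ) - s) / (Fintype.card β)) else 1) := by
    intro i
    split_ifs
    · rw [Finset.card_powersetCard, Finset.card_erase_of_mem (Finset.mem_univ _),
        Finset.card_univ, aux_choose _ _ hL hsL]
    · rw [Finset.card_powersetCard, Finset.card_univ, mul_one]
  rw [Finset.prod_congr rfl (fun i _ => h2 i), Finset.prod_mul_distrib, Finset.prod_const,
    Finset.card_univ, Finset.prod_ite_mem, Finset.univ_inter, Finset.prod_const]


/-- **Exact CnCZK detection probability for the worst-case adversary.**
Each corrupted point `i ∈ B` has exactly one corrupted layer `ℓ i`.  The verifier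
samples a uniformly random `m`-element subset `S` of the `N` points and, independently
for each point, a uniformly random `s`-element subset `T i` of the `L` layers;
detection occurs iff some `i ∈ S ∩ B` has `ℓ i ∈ T i`.  The detection probability
equals `∑_k C(c,k)C(N-c,m-k)/C(N,m) · (1 - ((L-s)/L)^k)`. -/
theorem cnczk_detection_prob_single_layer
    (α β : Type) [Fintype α] [DecidableEq α] [Fintype β] [DecidableEq β]
    (N L s m c : ℕ)
    (hN : Fintype.card α = N) (hL : Fintype.card β = L)
    (B : Finset α) (hB : B.card = c) (hcN : c ≤ N)
    (hs1 : 1 ≤ s) (hsL : s ≤ L) (hm : m ≤ N)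
    (ℓ : α → β) :
    (((((Finset.univ : Finset α).powersetCard m) ×ˢ
          (Fintype.piFinset fun _ : α => (Finset.univ : Finset β).powersetCard s)).filter
          (fun p => ∃ i ∈ p.1 ∩ B, ℓ i ∈ p.2 i)).card : ℝ) /
      ((((Finset.univ : Finset α).powersetCard m) ×ˢ
          (Fintype.piFinset fun _ : α => (Finset.univ : Finset β).powersetCard s)).card : ℝ)
    = ∑ k ∈ Finset.range (min c m + 1),
        ((Nat.choose c k * Nat.choose (N - c) (m - k) : ℝ) / (Nat.choose N m : ℝ)) *
          (1 - (((L : ℝ) - s) / L) ^ k) := by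
  subst hN hL hB
  set q : ℝ := ((Fintype.card β : ℝ) - s) / (Fintype.card β) with hq
  set P := Fintype.piFinset fun _ : α => (Finset.univ : Finset β).powersetCard s with hP
  set M : ℝ := ((Fintype.card β).choose s : ℝ) ^ (Fintype.card α) with hM
  have hPc : (P.card : ℝ) = M := by
    rw [hP, Fintype.card_piFinset, hM]
    simp
  have hM0 : M ≠ 0 := by
    have := Nat.choose_pos hsL
    positivity
  have hC0 : ((Fintype.card α).choose m : ℝ) ≠ 0 := by
    have := Nat.choose_pos hm
    positivity
  have hdet : ∀ S : Finset α, ((P.filter (fun T => ∃ i ∈ S ∩ B, ℓ i ∈ T i)).card : ℝ)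
      = M * (1 - q ^ (S ∩ B).card) := by
    intro S
    have h1 := aux_miss s (hs1.trans hsL) hsL (S ∩ B) ℓ
    have h2 := Finset.card_filter_add_card_filter_not (s := P) (fun T => ∃ i ∈ S ∩ B, ℓ i ∈ T i)
    have h3 : ((P.filter (fun T => ∃ i ∈ S ∩ B, ℓ i ∈ T i)).card : ℝ)
      + ((P.filter (fun T => ¬ ∃ i ∈ S ∩ B, ℓ i ∈ T i)).card : ℝ) = M := by
      rw [← hPc]
      exact_mod_cast h2
    rw [h1] at h3
    linear_combination h3
  have hnum : (((((Finset.univ : Finset α).powersetCard m) ×ˢ P).filter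
          (fun p => ∃ i ∈ p.1 ∩ B, ℓ i ∈ p.2 i)).card : ℝ)
      = ∑ S ∈ (Finset.univ : Finset α).powersetCard m, M * (1 - q ^ (S ∩ B).card) := by
    rw [Finset.card_filter, Finset.sum_product, Nat.cast_sum]
    refine Finset.sum_congr rfl fun S _ => ?_
    rw [← hdet S, Finset.card_filter]
  have hmaps : ∀ S ∈ (Finset.univ : Finset α).powersetCard m,
      (S ∩ B).card ∈ Finset.range (min B.card m + 1) := by
    intro S hS
    rw [Finset.mem_powersetCard] at hS
    have h1 := Finset.card_le_card (Finset.inter_subset_left (s₁ := S) (s₂ := B))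
    have h2 := Finset.card_le_card (Finset.inter_subset_right (s₁ := S) (s₂ := B))
    rw [Finset.mem_range]
    omega
  rw [hnum, ← Finset.sum_fiberwise_of_maps_to hmaps, Finset.card_product, Nat.cast_mul, hPc,
    Finset.card_powersetCard, Finset.card_univ, Finset.sum_div]
  refine Finset.sum_congr rfl fun k hk => ?_
  have hkm : k ≤ m := by
    rw [Finset.mem_range] at hk
    omega
  have hc : ∑ S ∈ ((Finset.univ : Finset α).powersetCard m).filter (fun S => (S ∩ B).card = k),
      M * (1 - q ^ (S ∩ B).card)
      = ((B.card.choose k : ℝ) * ((Fintype.card α - B.card).choose (m - k) : ℝ))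
        * (M * (1 - q ^ k)) := by
    rw [Finset.sum_congr rfl (g := fun _ => M * (1 - q ^ k))
      (fun S hS => by rw [(Finset.mem_filter.1 hS).2]), Finset.sum_const, aux_hyper B m k hkm,
      nsmul_eq_mul, Nat.cast_mul]
  rw [hc]
  field_simp
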